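/- Let N ≥ 1, let ω₁,…,ω_N be positive real numbers, let s ∈ ℂ with Re s > N, and let m ∈ ℕ. Then the m-th complex derivative of the function x ↦ ζ_{E,N}(s,x;ω̄) on the right half-plane {x : Re x > 0}, evaluated at any x with Re x > 0, equals (−1)^m·(s)_m·ζ_{E,N}(s+m, x; ω̄), where (s)_m = s(s+1)⋯(s+m−1) is the Pochhammer symbol, with (s)_0 = 1. -/

import Mathlib

/-- The multiple Barnes–Euler zeta function
`ζ_{E,N}(s,x;ω̄) = ∑_{t̄∈ℕ^N} (−1)^{t₁+⋯+t_N} (x+ω₁t₁+⋯+ω_Nt_N)^{−s}`,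
where `z^{−s} = exp(−s·Log z)` is the principal complex power. -/
noncomputable def zetaE (N : ℕ) (ω : Fin N → ℝ) (x s : ℂ) : ℂ :=
  ∑' t : Fin N → ℕ, (-1 : ℂ) ^ (∑ i, t i) * (x + ∑ i, (ω i : ℂ) * (t i : ℂ)) ^ (-s)

theorem aux_summable_prod (N : ℕ) (f : Fin N → ℕ → ℝ) (hf : ∀ i n, 0 ≤ f i n)
    (hs : ∀ i, Summable (f i)) : Summable (fun t : Fin N → ℕ => ∏ i, f i (t i)) := by
  induction N with
  | zero => exact (hasSum_fintype _).summable
  | succ n ih =>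
    have h1 := ih (fun i => f i.succ) (fun i => hf _) (fun i => hs _)
    have h2 := (hs 0).mul_of_nonneg h1 (fun n => hf 0 n)
      (fun t => Finset.prod_nonneg (fun i _ => hf _ _))
    rw [← (Fin.consEquiv (fun _ : Fin (n+1) => ℕ)).summable_iff]
    refine h2.congr (fun t => ?_)
    simp [Fin.prod_univ_succ, Fin.consEquiv]

theorem aux_summable_one (c w p : ℝ) (hc : 0 < c) (hw : 0 < w) (hp : 1 < p) :
    Summable (fun n : ℕ => (c + w * n) ^ (-p)) := by
  have h : Summable (fun n : ℕ => w ^ (-p) * (n : ℝ) ^ (-p)) :=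
    (Real.summable_nat_rpow.2 (by linarith)).mul_left _
  rw [← summable_nat_add_iff 1] at h ⊢
  refine h.of_nonneg_of_le (fun n => by positivity) (fun n => ?_)
  rw [← Real.mul_rpow hw.le (by positivity)]
  apply Real.rpow_le_rpow_of_nonpos (by positivity) (by linarith) (by linarith)

theorem aux_summable (N : ℕ) (hN : 1 ≤ N) (ω : Fin N → ℝ) (hω : ∀ i, 0 < ω i)
    (c σ : ℝ) (hc : 0 < c) (hσ : N < σ) :
    Summable (fun t : Fin N → ℕ => (c + ∑ i, ω i * t i) ^ (-σ)) := by
  have hN' : (0 : ℝ) < N := by exact_mod_cast hN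
  have h := aux_summable_prod N (fun i n => (c + ω i * n) ^ (-(σ / N)))
    (fun i n => by have := hω i; positivity)
    (fun i => aux_summable_one c (ω i) _ hc (hω i) (by rwa [one_lt_div hN']))
  have hnn : ∀ (t : Fin N → ℕ) i, 0 ≤ ω i * t i := fun t i => by have := hω i; positivity
  have hS : ∀ (t : Fin N → ℕ), 0 ≤ ∑ i, ω i * t i := fun t => Finset.sum_nonneg fun i _ => hnn t i
  refine h.of_nonneg_of_le (fun t => Real.rpow_nonneg (by linarith [hS t]) _) (fun t => ?_)
  have e : (c + ∑ i, ω i * t i) ^ (-σ) = ∏ i : Fin N, (c + ∑ i, ω i * t i) ^ (-(σ / N)) := by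
    rw [Finset.prod_const, ← Real.rpow_mul_natCast (by linarith [hS t])]
    congr 1
    simp
    field_simp
  rw [e]
  refine Finset.prod_le_prod (fun i _ => Real.rpow_nonneg (by linarith [hS t]) _) (fun i _ => ?_)
  apply Real.rpow_le_rpow_of_nonpos (by linarith [hnn t i])
  · have := Finset.single_le_sum (f := fun i => ω i * (t i : ℝ)) (fun i _ => hnn t i) (Finset.mem_univ i)
    linarith
  · have : 0 < σ / N := div_pos (by linarith) hN'
    linarith

theorem aux_deriv (N : ℕ) (hN : 1 ≤ N) (ω : Fin N → ℝ) (hω : ∀ i, 0 < ω i)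
    (s : ℂ) (hs : (N : ℝ) < s.re) (x : ℂ) (hx : 0 < x.re) :
    HasDerivAt (fun y => zetaE N ω y s) (-s * zetaE N ω x (s + 1)) x := by
  have hN' : (0 : ℝ) < N := by exact_mod_cast hN
  have hre : ∀ (t : Fin N → ℕ) (y : ℂ),
      (y + ∑ i, (ω i : ℂ) * (t i : ℂ)).re = y.re + ∑ i, ω i * t i := fun t y => by simp
  have hS : ∀ (t : Fin N → ℕ), 0 ≤ ∑ i, ω i * t i := fun t =>
    Finset.sum_nonneg fun i _ => by have := hω i; positivity
  set U : Set ℂ := {z | x.re / 2 < z.re} with hU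
  have hUo : IsOpen U := isOpen_lt continuous_const Complex.continuous_re
  have hxU : x ∈ U := by simp [hU]; linarith
  have hd : ∀ (t : Fin N → ℕ) (y : ℂ), y ∈ U → HasDerivAt
      (fun y => (-1 : ℂ) ^ (∑ i, t i) * (y + ∑ i, (ω i : ℂ) * (t i : ℂ)) ^ (-s))
      (-s * ((-1 : ℂ) ^ (∑ i, t i) * (y + ∑ i, (ω i : ℂ) * (t i : ℂ)) ^ (-(s+1)))) y := by
    intro t y hy
    have hy' : x.re / 2 < y.re := hy
    have h1 : (y + ∑ i, (ω i : ℂ) * (t i : ℂ)) ∈ Complex.slitPlane :=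
      Or.inl (by rw [hre]; linarith [hS t])
    have h2 := (((hasDerivAt_id y).add_const (∑ i, (ω i : ℂ) * (t i : ℂ))).cpow_const (c := -s) h1).const_mul
      ((-1 : ℂ) ^ (∑ i, t i))
    refine h2.congr_deriv ?_
    rw [show -(s+1) = -s - 1 by ring]
    simp only [id]
    ring
  have hu := (aux_summable N hN ω hω (x.re / 2) s.re (by linarith) hs).mul_right
    (Real.exp (Real.pi * |s.im|))
  have hb : ∀ (t : Fin N → ℕ) (y : ℂ), y ∈ U →
      ‖(-1 : ℂ) ^ (∑ i, t i) * (y + ∑ i, (ω i : ℂ) * (t i : ℂ)) ^ (-s)‖ ≤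
      (x.re / 2 + ∑ i, ω i * t i) ^ (-s.re) * Real.exp (Real.pi * |s.im|) := by
    intro t y hy
    have hy' : x.re / 2 < y.re := hy
    rw [norm_mul, norm_pow, norm_neg, norm_one, one_pow, one_mul]
    set z := y + ∑ i, (ω i : ℂ) * (t i : ℂ) with hz
    have hzr : x.re / 2 + ∑ i, ω i * t i ≤ z.re := by rw [hre]; linarith
    refine (Complex.norm_cpow_le z (-s)).trans ?_
    rw [div_eq_mul_inv, ← Real.exp_neg, Complex.neg_re, Complex.neg_im]
    refine mul_le_mul ?_ (Real.exp_le_exp.2 ?_) (Real.exp_pos _).le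
      (Real.rpow_nonneg (by linarith [hS t]) _)
    · apply Real.rpow_le_rpow_of_nonpos (by linarith [hS t])
        (hzr.trans (Complex.re_le_norm z)) (by linarith)
    · have h1 := Complex.abs_arg_le_pi z
      calc -(z.arg * -s.im) ≤ |z.arg * s.im| := by rw [mul_neg, neg_neg]; exact le_abs_self _
        _ = |z.arg| * |s.im| := abs_mul _ _
        _ ≤ _ := by gcongr
  have hdiff := Complex.differentiableOn_tsum_of_summable_norm hu
    (fun t y hy => (hd t y hy).differentiableAt.differentiableWithinAt) hUo hb
  have hsum := Complex.hasSum_deriv_of_summable_norm hu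
    (fun t y hy => (hd t y hy).differentiableAt.differentiableWithinAt) hUo hb hxU
  have hD := (hdiff.differentiableAt (hUo.mem_nhds hxU)).hasDerivAt
  rw [← hsum.tsum_eq] at hD
  simp only [(hd _ x hxU).deriv, tsum_mul_left] at hD
  exact hD

theorem stmt4 (N : ℕ) (hN : 1 ≤ N) (ω : Fin N → ℝ) (hω : ∀ i, 0 < ω i)
    (s : ℂ) (hs : (N : ℝ) < s.re) (m : ℕ) (x : ℂ) (hx : 0 < x.re) :
    iteratedDerivWithin m (fun y => zetaE N ω y s) {z : ℂ | 0 < z.re} x =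
      (-1 : ℂ) ^ m * (ascPochhammer ℂ m).eval s * zetaE N ω x (s + (m : ℂ)) := by
  have hUo : IsOpen {z : ℂ | 0 < z.re} := isOpen_lt continuous_const Complex.continuous_re
  induction m generalizing x with
  | zero => simp
  | succ m ih =>
    have hxm : x ∈ {z : ℂ | 0 < z.re} := hx
    rw [iteratedDerivWithin_succ, derivWithin_congr (s := {z : ℂ | 0 < z.re}) (fun y hy => ih y hy) (ih x hx),
      derivWithin_of_isOpen hUo hxm]
    have h := (aux_deriv N hN ω hω (s + m) (by
      have : (0 : ℝ) ≤ m := Nat.cast_nonneg m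
      simp; linarith) x hx).const_mul ((-1 : ℂ) ^ m * (ascPochhammer ℂ m).eval s)
    rw [h.deriv, ascPochhammer_succ_eval]
    push_cast
    rw [add_assoc s]
    ring
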